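/- Suppose the k-cycle (a_1 ... a_k) in S_n equals a product of exactly k - 1 transpositions. Then at least one of these transposition factors equals (a_i a_{i+1}) for some index i with 1 ≤ i < k. -/

import Mathlib

open Module Submodule in
theorem finrank_span_list_le_length {V : Type*} [AddCommGroup V] [Module ℚ V] (L : List V) :
    finrank ℚ (span ℚ {x | x ∈ L}) ≤ L.length := by
  classical
  have h := finrank_span_finset_le_card (R := ℚ) L.toFinset
  rw [List.coe_toFinset] at h
  exact h.trans L.toFinset_card_le

open Module Submodule in
/-- If a nonempty list of vectors has full rank, then its tail has full rank
and does not span its head. -/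
theorem full_rank_tail_of_cons {V : Type*} [AddCommGroup V] [Module ℚ V] {v : V} {L : List V}
    (h : (v :: L).length ≤ finrank ℚ (span ℚ {x | x ∈ v :: L})) :
    v ∉ span ℚ {x | x ∈ L} ∧ L.length ≤ finrank ℚ (span ℚ {x | x ∈ L}) := by
  have hset : {x | x ∈ v :: L} = insert v {x | x ∈ L} := by ext; simp
  have hfin : FiniteDimensional ℚ (span ℚ {x | x ∈ L}) :=
    FiniteDimensional.span_of_finite ℚ L.finite_toSet
  rw [hset, List.length_cons] at h
  constructor
  · intro hv
    rw [span_insert_eq_span hv] at h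
    have := finrank_span_list_le_length L
    omega
  · rw [span_insert] at h
    have h₁ := finrank_add_le_finrank_add_finrank (span ℚ {v}) (span ℚ {x | x ∈ L})
    have h₂ := finrank_span_list_le_length [v]
    have h₃ : {x | x ∈ [v]} = {v} := by ext; simp
    rw [h₃, List.length_singleton] at h₂
    omega

/-- The root `e_u - e_v` of the transposition `(u v)`. -/
def swapRoot {α : Type*} [DecidableEq α] (p : α × α) : α → ℚ :=
  Pi.single p.1 1 - Pi.single p.2 1

section

variable {α : Type*} [DecidableEq α]

theorem sub_comp_swap (f : α → ℚ) (p : α × α) :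
    f - f ∘ Equiv.swap p.1 p.2 = (f p.1 - f p.2) • swapRoot p := by
  ext x
  simp only [swapRoot, Pi.sub_apply, Pi.smul_apply, Function.comp_apply, Equiv.swap_apply_def,
    Pi.single_apply, smul_eq_mul]
  split_ifs <;> simp_all

theorem sub_comp_prod_swap_mem_span (T : List (α × α)) (f : α → ℚ) :
    f - f ∘ (T.map fun p => Equiv.swap p.1 p.2).prod ∈
      Submodule.span ℚ {x | x ∈ T.map swapRoot} := by
  induction T generalizing f with
  | nil => simp
  | cons t T ih =>
    have hsplit : f - f ∘ ((t :: T).map fun p => Equiv.swap p.1 p.2).prod =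
        (f - f ∘ Equiv.swap t.1 t.2) + (f ∘ Equiv.swap t.1 t.2 -
          (f ∘ Equiv.swap t.1 t.2) ∘ (T.map fun p => Equiv.swap p.1 p.2).prod) := by
      ext x
      simp
    rw [hsplit, sub_comp_swap]
    refine add_mem (Submodule.smul_mem _ _ (Submodule.subset_span (by simp))) ?_
    refine Submodule.span_mono ?_ (ih _)
    intro x hx
    exact List.mem_cons_of_mem _ hx

/-- A function invariant under a product of transpositions with linearly independent roots takes
equal values at the two points moved by the first factor. -/
theorem apply_eq_of_comp_prod_swap_eq {t : α × α} {T : List (α × α)}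
    (hT : swapRoot t ∉ Submodule.span ℚ {x | x ∈ T.map swapRoot}) {f : α → ℚ}
    (hf : ∀ x, f (((t :: T).map fun p => Equiv.swap p.1 p.2).prod x) = f x) :
    f t.1 = f t.2 := by
  by_contra hne
  apply hT
  have hmem := sub_comp_prod_swap_mem_span T (f ∘ Equiv.swap t.1 t.2)
  have heq : f ∘ Equiv.swap t.1 t.2 -
      (f ∘ Equiv.swap t.1 t.2) ∘ (T.map fun p => Equiv.swap p.1 p.2).prod =
        -(f - f ∘ Equiv.swap t.1 t.2) := by
    ext x
    have := hf x
    simp only [List.map_cons, List.prod_cons, Equiv.Perm.mul_apply] at this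
    simp [this]
  rw [heq, neg_mem_iff, sub_comp_swap] at hmem
  exact (Submodule.smul_mem_iff _ (sub_ne_zero.mpr hne)).mp hmem

/-- If a product of transpositions with linearly independent roots has a cycle
`(a i, a (i + 1), ..., a j)`, then one factor is `(a s, a (s + 1))` with `i ≤ s < j`. -/
theorem exists_swap_eq_swap_succ (a : ℕ → α) (T : List (α × α)) (hne : ∀ p ∈ T, p.1 ≠ p.2)
    (hT : (T.map swapRoot).length ≤
      Module.finrank ℚ (Submodule.span ℚ {x | x ∈ T.map swapRoot}))
    {i j : ℕ} (hij : i < j) (ha : Set.InjOn a (Set.Icc i j))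
    (hstep : ∀ s, i ≤ s → s < j →
      (T.map fun p => Equiv.swap p.1 p.2).prod (a s) = a (s + 1))
    (hlast : (T.map fun p => Equiv.swap p.1 p.2).prod (a j) = a i) :
    ∃ p ∈ T, ∃ s, i ≤ s ∧ s < j ∧ Equiv.swap p.1 p.2 = Equiv.swap (a s) (a (s + 1)) := by
  induction T generalizing i j with
  | nil =>
    have := ha ⟨le_rfl, hij.le⟩ ⟨by omega, by omega⟩ (hstep i le_rfl hij)
    omega
  | cons t T ih =>
    obtain ⟨hspan, hrank⟩ := full_rank_tail_of_cons hT
    have ih := @ih (fun p hp => hne p (List.mem_cons_of_mem _ hp)) hrank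
    have ht : t.1 ≠ t.2 := hne t List.mem_cons_self
    set σ := ((t :: T).map fun p => Equiv.swap p.1 p.2).prod with hσ
    have hτ : ∀ x, (T.map fun p => Equiv.swap p.1 p.2).prod x = Equiv.swap t.1 t.2 (σ x) := by
      intro x
      simp [hσ]
    have hinv : ∀ x, σ x ∈ a '' Set.Icc i j ↔ x ∈ a '' Set.Icc i j := by
      intro x
      constructor
      · rintro ⟨s, ⟨his, hsj⟩, hs⟩
        rcases his.eq_or_lt with rfl | his
        · exact ⟨j, ⟨hsj, le_rfl⟩, σ.injective (hlast.trans hs)⟩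
        · obtain ⟨r, rfl⟩ : ∃ r, s = r + 1 := ⟨s - 1, by omega⟩
          exact ⟨r, ⟨by omega, by omega⟩,
            σ.injective ((hstep r (by omega) (by omega)).trans hs)⟩
      · rintro ⟨s, ⟨his, hsj⟩, rfl⟩
        rcases hsj.eq_or_lt with rfl | hsj
        · exact ⟨i, ⟨le_rfl, his⟩, hlast.symm⟩
        · exact ⟨s + 1, ⟨by omega, by omega⟩, (hstep s his hsj).symm⟩
    have hmem : t.1 ∈ a '' Set.Icc i j ↔ t.2 ∈ a '' Set.Icc i j := by
      classical
      have h := apply_eq_of_comp_prod_swap_eq hspan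
        (f := fun x => if x ∈ a '' Set.Icc i j then (1 : ℚ) else 0)
        (fun x => by simp only [← hσ, hinv])
      by_cases h₁ : t.1 ∈ a '' Set.Icc i j <;> by_cases h₂ : t.2 ∈ a '' Set.Icc i j <;>
        simp only [h₁, h₂, if_true, if_false] at h ⊢ <;> norm_num at h
    by_cases h₁ : t.1 ∈ a '' Set.Icc i j
    · have key : ∀ p q, i ≤ p → p < q → q ≤ j →
          Equiv.swap t.1 t.2 = Equiv.swap (a p) (a q) →
          ∃ p ∈ t :: T, ∃ s, i ≤ s ∧ s < j ∧
            Equiv.swap p.1 p.2 = Equiv.swap (a s) (a (s + 1)) := by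
        intro p q hip hpq hqj hswap
        obtain ⟨r, rfl⟩ : ∃ r, q = r + 1 := ⟨q - 1, by omega⟩
        rcases (Nat.lt_succ_iff.mp hpq).eq_or_lt with rfl | hpr
        · exact ⟨t, List.mem_cons_self, p, hip, by omega, hswap⟩
        · obtain ⟨c, hc, s, hs₁, hs₂, hs⟩ := ih hpr
            (ha.mono (Set.Icc_subset_Icc hip (by omega)))
            (fun s hs₁ hs₂ => by
              rw [hτ, hstep s (by omega) (by omega), hswap]
              refine Equiv.swap_apply_of_ne_of_ne (fun h => ?_) (fun h => ?_)
              · have := ha ⟨by omega, by omega⟩ ⟨by omega, by omega⟩ h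
                omega
              · have := ha ⟨by omega, by omega⟩ ⟨by omega, by omega⟩ h
                omega)
            (by rw [hτ, hstep r (by omega) (by omega), hswap, Equiv.swap_apply_right])
          exact ⟨c, List.mem_cons_of_mem _ hc, s, by omega, by omega, hs⟩
      obtain ⟨p, ⟨hip, hpj⟩, hp⟩ := h₁
      obtain ⟨q, ⟨hiq, hqj⟩, hq⟩ := hmem.mp ⟨p, ⟨hip, hpj⟩, hp⟩
      rcases lt_trichotomy p q with hpq | rfl | hqp
      · exact key p q hip hpq hqj (by rw [hp, hq])
      · exact absurd (hp.symm.trans hq) ht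
      · exact key q p hiq hqp hpj (by rw [hp, hq, Equiv.swap_comm])
    · have h₂ := fun h => h₁ (hmem.mpr h)
      have hfix : ∀ s, i ≤ s → s ≤ j → Equiv.swap t.1 t.2 (a s) = a s := fun s his hsj =>
        Equiv.swap_apply_of_ne_of_ne (fun h => h₁ ⟨s, ⟨his, hsj⟩, h⟩)
          (fun h => h₂ ⟨s, ⟨his, hsj⟩, h⟩)
      obtain ⟨c, hc, s, hs⟩ := ih hij ha
        (fun s hs₁ hs₂ => by rw [hτ, hstep s hs₁ hs₂, hfix _ (by omega) (by omega)])
        (by rw [hτ, hlast, hfix _ le_rfl hij.le])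
      exact ⟨c, List.mem_cons_of_mem _ hc, s, hs⟩

/-- If a product of `j - i` transpositions maps `a s` to `a (s + 1)` for `i ≤ s < j`, where
`a i, ..., a j` are distinct, then the roots of these transpositions are linearly independent. -/
theorem length_le_finrank_span_swapRoot (a : ℕ → α) (T : List (α × α)) {i j : ℕ}
    (hlen : T.length = j - i) (hij : i ≤ j) (ha : Set.InjOn a (Set.Icc i j))
    (hstep : ∀ s, i ≤ s → s < j →
      (T.map fun p => Equiv.swap p.1 p.2).prod (a s) = a (s + 1)) :
    (T.map swapRoot).length ≤
      Module.finrank ℚ (Submodule.span ℚ {x | x ∈ T.map swapRoot}) := by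
  let L : List (α → ℚ) := Pi.single (a i) 1 :: T.map swapRoot
  refine (full_rank_tail_of_cons (v := Pi.single (a i) 1) ?_).2
  change L.length ≤ Module.finrank ℚ (Submodule.span ℚ {x | x ∈ L})
  have hfin : FiniteDimensional ℚ (Submodule.span ℚ {x | x ∈ L}) :=
    FiniteDimensional.span_of_finite ℚ L.finite_toSet
  have hmem : ∀ s, i ≤ s → s ≤ j →
      (Pi.single (a s) 1 : α → ℚ) ∈ Submodule.span ℚ {x | x ∈ L} := by
    intro s his
    induction s, his using Nat.le_induction with
    | base => exact fun _ => Submodule.subset_span List.mem_cons_self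
    | succ s his ih =>
      intro hsj
      have h := sub_comp_prod_swap_mem_span T (Pi.single (a (s + 1)) 1)
      have hcomp : (Pi.single (a (s + 1)) 1 : α → ℚ) ∘
          (T.map fun p => Equiv.swap p.1 p.2).prod = Pi.single (a s) 1 := by
        ext x
        simp only [Function.comp_apply, Pi.single_apply, ← hstep s his (by omega),
          EmbeddingLike.apply_eq_iff_eq]
      rw [hcomp] at h
      have h' : (Pi.single (a (s + 1)) 1 - Pi.single (a s) 1 : α → ℚ) ∈
          Submodule.span ℚ {x | x ∈ L} :=
        Submodule.span_mono (fun x hx => List.mem_cons_of_mem _ hx) h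
      simpa using add_mem h' (ih (by omega))
  have hli : LinearIndependent ℚ
      (fun s : Set.Icc i j => (Pi.single (a s) 1 : α → ℚ)) :=
    (Pi.linearIndependent_single_one α ℚ).comp (fun s : Set.Icc i j => a s) ha.injective
  have hcard := linearIndependent_iff_card_eq_finrank_span.mp hli
  have hle := Submodule.finrank_mono (R := ℚ) (Submodule.span_le.mpr
    (show Set.range (fun s : Set.Icc i j => (Pi.single (a s) 1 : α → ℚ)) ⊆
        (Submodule.span ℚ {x | x ∈ L} : Set (α → ℚ)) by
      rintro _ ⟨⟨s, hs⟩, rfl⟩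
      exact hmem s hs.1 hs.2))
  rw [Set.finrank] at hcard
  have hIcc : Fintype.card (Set.Icc i j) = j + 1 - i := by simp
  have hL : L.length = T.length + 1 := by simp [L]
  omega

end

/-- Lemma 1(c): if the `k`-cycle `(a₁ ... a_k)` in `S_n` equals a product of
exactly `k - 1` transpositions, then some factor equals `(a_i a_{i+1})` for
some `1 ≤ i < k`. Here the cycle is `(a 1, a 2, ..., a k)`. -/
theorem stmt5 (n k : ℕ) (hk : 2 ≤ k) (hkn : k ≤ n) (a : ℕ → ℕ)
    (hinj : Set.InjOn a (Set.Icc 1 k))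
    (hrange : ∀ i ∈ Finset.Icc 1 k, a i ∈ Finset.Icc 1 n)
    (T : List (ℕ × ℕ))
    (hT : ∀ p ∈ T, p.1 ≠ p.2 ∧ p.1 ∈ Finset.Icc 1 n ∧ p.2 ∈ Finset.Icc 1 n)
    (hTlen : T.length = k - 1)
    (hprod : ((List.range k).map fun i => a (i + 1)).formPerm =
      (T.map fun p => Equiv.swap p.1 p.2).prod) :
    ∃ p ∈ T, ∃ i, 1 ≤ i ∧ i < k ∧
      Equiv.swap p.1 p.2 = Equiv.swap (a i) (a (i + 1)) := by
  set l := (List.range k).map fun i => a (i + 1) with hl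
  have hlen : l.length = k := by simp [hl]
  have hnodup : l.Nodup := by
    refine List.Nodup.map_on (fun x hx y hy hxy => ?_) List.nodup_range
    rw [List.mem_range] at hx hy
    have := hinj ⟨by omega, by omega⟩ ⟨by omega, by omega⟩ hxy
    omega
  have hcycle : ∀ s, s < k →
      (T.map fun p => Equiv.swap p.1 p.2).prod (a (s + 1)) = a ((s + 1) % k + 1) := by
    intro s hs
    have h := List.formPerm_apply_getElem l hnodup s (by omega)
    rw [← hprod]
    simpa [hl] using h
  have hstep : ∀ s, 1 ≤ s → s < k →
      (T.map fun p => Equiv.swap p.1 p.2).prod (a s) = a (s + 1) := by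
    intro s hs₁ hs₂
    have h := hcycle (s - 1) (by omega)
    rwa [Nat.sub_add_cancel hs₁, Nat.mod_eq_of_lt hs₂] at h
  have hlast : (T.map fun p => Equiv.swap p.1 p.2).prod (a k) = a 1 := by
    have h := hcycle (k - 1) (by omega)
    rwa [Nat.sub_add_cancel (by omega), Nat.mod_self] at h
  exact exists_swap_eq_swap_succ a T (fun p hp => (hT p hp).1)
    (length_le_finrank_span_swapRoot a T hTlen (by omega) hinj hstep) (by omega) hinj hstep hlast
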